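/- arXiv:2510.23611 — 15 statements merged into one kernel-verified Lean document; each statement's English description precedes it below -/
import Mathlib

section
/- Let A be a Com-PreLie algebra, V a k-vector space, and μ, l, r : A → End(V) linear maps. Then (V, μ, l, r) is a representation of A if and only if the direct sum A ⊕ V becomes a Com-PreLie algebra under the products (x+u) ∗ (y+v) = x∗y + μ(x)v + μ(y)u and (x+u) • (y+v) = x•y + l(x)v + r(y)u (the semi-direct product). -/
universe u

variable (k : Type u) [Field k] [CharZero k]

/-- A Com-PreLie algebra: a commutative associative product `mul` and a (left)
pre-Lie product `pre` satisfying the compatibility (Leibniz) condition. -/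
structure ComPreLie (A : Type*) [AddCommGroup A] [Module k A] where
  mul : A →ₗ[k] A →ₗ[k] A
  pre : A →ₗ[k] A →ₗ[k] A
  mul_comm' : ∀ x y, mul x y = mul y x
  mul_assoc' : ∀ x y z, mul (mul x y) z = mul x (mul y z)
  pre_lie : ∀ x y z, pre (pre x y) z - pre x (pre y z) = pre (pre y x) z - pre y (pre x z)
  compat : ∀ x y z, pre x (mul y z) = mul (pre x y) z + mul y (pre x z)

variable {A B B' V : Type*}
  [AddCommGroup A] [Module k A] [AddCommGroup B] [Module k B]
  [AddCommGroup B'] [Module k B'] [AddCommGroup V] [Module k V]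

/-- A representation `(V, μ, l, r)` of a Com-PreLie algebra. -/
def IsRep (C : ComPreLie k A) (μ l r : A →ₗ[k] Module.End k V) : Prop :=
  (∀ x y, μ (C.mul x y) = μ x * μ y) ∧
  (∀ x y, l (C.pre x y) - l x * l y = l (C.pre y x) - l y * l x) ∧
  (∀ x y, r y * l x - l x * r y = r y * r x - r (C.pre x y)) ∧
  (∀ x y, l x * μ y = μ (C.pre x y) + μ y * l x) ∧
  (∀ x y, r (C.mul x y) = μ y * r x + μ x * r y)

/-- A 2-cocycle `(φ, ψ)` of a Com-PreLie algebra with coefficients in a representation. -/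
def IsTwoCocycle (C : ComPreLie k A) (μ l r : A →ₗ[k] Module.End k V)
    (φ ψ : A → A → V) : Prop :=
  (∀ x y, φ x y = φ y x) ∧
  (∀ x y z, φ x (C.mul y z) + μ x (φ y z) - φ (C.mul x y) z - μ z (φ x y) = 0) ∧
  (∀ x y z, ψ (C.pre x y) z + r z (ψ x y) - ψ x (C.pre y z) - l x (ψ y z)
      - ψ (C.pre y x) z - r z (ψ y x) + ψ y (C.pre x z) + l y (ψ x z) = 0) ∧
  (∀ x y z, ψ x (C.mul y z) + l x (φ y z) - φ (C.pre x y) z - μ z (ψ x y)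
      - φ y (C.pre x z) - μ y (ψ x z) = 0)

/-- A homomorphism of Com-PreLie algebras (a linear map preserving both products). -/
def IsCPLHom (C1 : ComPreLie k A) (C2 : ComPreLie k B) (f : A →ₗ[k] B) : Prop :=
  (∀ x y, f (C1.mul x y) = C2.mul (f x) (f y)) ∧
  (∀ x y, f (C1.pre x y) = C2.pre (f x) (f y))

/-- An abelian extension: a surjective Com-PreLie homomorphism whose kernel has
trivial products. -/
def IsAbelianExtension (CB : ComPreLie k B) (CA : ComPreLie k A) (j : B →ₗ[k] A) : Prop :=
  Function.Surjective j ∧ IsCPLHom k CB CA j ∧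
  (∀ u v : B, j u = 0 → j v = 0 → CB.mul u v = 0 ∧ CB.pre u v = 0)

/-- The `φ`-component of the 2-cocycle associated to a section `s`. -/
def extPhi (CB : ComPreLie k B) (CA : ComPreLie k A) (s : A →ₗ[k] B) : A → A → B :=
  fun x y => CB.mul (s x) (s y) - s (CA.mul x y)

/-- The `ψ`-component of the 2-cocycle associated to a section `s`. -/
def extPsi (CB : ComPreLie k B) (CA : ComPreLie k A) (s : A →ₗ[k] B) : A → A → B :=
  fun x y => CB.pre (s x) (s y) - s (CA.pre x y)

/-- The bilinear product `(x + u)(y + v) = xy + f(x)v + g(y)u` on `A × V`. -/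
def semidirectProduct (m : A →ₗ[k] A →ₗ[k] A) (f g : A →ₗ[k] Module.End k V) :
    (A × V) →ₗ[k] (A × V) →ₗ[k] (A × V) :=
  LinearMap.mk₂ k (fun p q => (m p.1 q.1, f p.1 q.2 + g q.1 p.2))
    (fun p p' q => by ext <;> simp; abel)
    (fun c p q => by ext <;> simp)
    (fun p q q' => by ext <;> simp; abel)
    (fun c p q => by ext <;> simp)

/-- `(V, μ, l, r)` is a representation of `A` iff the semi-direct
product operations make `A ⊕ V` a Com-PreLie algebra. -/
theorem statement0 (C : ComPreLie k A) (μ l r : A →ₗ[k] Module.End k V) :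
    IsRep k C μ l r ↔
      ∃ CB : ComPreLie k (A × V),
        (∀ p q : A × V, CB.mul p q = (C.mul p.1 q.1, μ p.1 q.2 + μ q.1 p.2)) ∧
        (∀ p q : A × V, CB.pre p q = (C.pre p.1 q.1, l p.1 q.2 + r q.1 p.2)) := by
  constructor
  · rintro ⟨hμ, hl, hrl, hlμ, hr⟩
    have hμ' (x y v) : μ (C.mul x y) v = μ x (μ y v) := by simp [hμ]
    have hμ_comm (x y v) : μ x (μ y v) = μ y (μ x v) := by
      rw [← hμ', ← hμ', C.mul_comm']
    have hl' (x y v) : l (C.pre x y) v - l x (l y v) = l (C.pre y x) v - l y (l x v) :=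
      LinearMap.congr_fun (hl x y) v
    have hrl' (x y v) : r y (l x v) - l x (r y v) = r y (r x v) - r (C.pre x y) v :=
      LinearMap.congr_fun (hrl x y) v
    have hlμ' (x y v) : l x (μ y v) = μ (C.pre x y) v + μ y (l x v) :=
      LinearMap.congr_fun (hlμ x y) v
    have hr' (x y v) : r (C.mul x y) v = μ y (r x v) + μ x (r y v) :=
      LinearMap.congr_fun (hr x y) v
    refine ⟨⟨semidirectProduct k C.mul μ μ, semidirectProduct k C.pre l r, ?_, ?_, ?_, ?_⟩,
      fun _ _ => rfl, fun _ _ => rfl⟩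
    · intro p q
      ext
      · exact C.mul_comm' _ _
      · exact add_comm _ _
    · rintro ⟨x, u⟩ ⟨y, v⟩ ⟨z, w⟩
      ext
      · exact C.mul_assoc' _ _ _
      · simp only [semidirectProduct, LinearMap.mk₂_apply, map_add, hμ', hμ_comm z]
        abel
    · rintro ⟨x, u⟩ ⟨y, v⟩ ⟨z, w⟩
      ext
      · exact C.pre_lie _ _ _
      · simp only [semidirectProduct, LinearMap.mk₂_apply, map_add, Prod.snd_sub]
        linear_combination (norm := abel) hl' x y w + hrl' x z v - hrl' y z u
    · rintro ⟨x, u⟩ ⟨y, v⟩ ⟨z, w⟩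
      ext
      · exact C.compat _ _ _
      · simp only [semidirectProduct, LinearMap.mk₂_apply, map_add, Prod.snd_add, hlμ', hr']
        abel
  · rintro ⟨CB, hmul, hpre⟩
    refine ⟨fun x y => ?_, fun x y => ?_, fun x y => ?_, fun x y => ?_, fun x y => ?_⟩ <;>
      ext v
    · simpa [hmul] using congrArg Prod.snd (CB.mul_assoc' (x, 0) (y, 0) (0, v))
    · simpa [hpre] using congrArg Prod.snd (CB.pre_lie (x, 0) (y, 0) (0, v))
    · simpa [hpre] using congrArg Prod.snd (CB.pre_lie (x, 0) (0, v) (y, 0))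
    · simpa [hmul, hpre] using congrArg Prod.snd (CB.compat (x, 0) (y, 0) (0, v))
    · simpa [hmul, hpre] using congrArg Prod.snd (CB.compat (0, v) (x, 0) (y, 0))
end

section
/- Let A be a Com-PreLie algebra and (V, μ, l, r) a representation of A. For any linear map N : A → V, the pair (φ, ψ) defined by φ(x,y) = μ(x)N(y) − N(x∗y) + μ(y)N(x) and ψ(x,y) = l(x)N(y) − N(x•y) + r(y)N(x) is a 2-cocycle of A with coefficients in V (i.e., every 2-coboundary is a 2-cocycle). -/
universe u

variable (k : Type u) [Field k] [CharZero k]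

variable {A B B' V : Type*}
  [AddCommGroup A] [Module k A] [AddCommGroup B] [Module k B]
  [AddCommGroup B'] [Module k B'] [AddCommGroup V] [Module k V]

/-- every 2-coboundary (coming from a linear map `N : A → V`) is a
2-cocycle. -/
theorem statement1 (C : ComPreLie k A) (μ l r : A →ₗ[k] Module.End k V)
    (hrep : IsRep k C μ l r) (N : A →ₗ[k] V) :
    IsTwoCocycle k C μ l r
      (fun x y => μ x (N y) - N (C.mul x y) + μ y (N x))
      (fun x y => l x (N y) - N (C.pre x y) + r y (N x)) := by
  obtain ⟨hμ, hl, hlr, hlμ, hr⟩ := hrep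
  have hμ' x y v : μ (C.mul x y) v = μ x (μ y v) := by simp [hμ]
  have hl' x y v : l (C.pre x y) v - l x (l y v) = l (C.pre y x) v - l y (l x v) := by
    simpa using LinearMap.congr_fun (hl x y) v
  have hlr' x y v : r y (l x v) - l x (r y v) = r y (r x v) - r (C.pre x y) v := by
    simpa using LinearMap.congr_fun (hlr x y) v
  have hlμ' x y v : l x (μ y v) = μ (C.pre x y) v + μ y (l x v) := by
    simpa using LinearMap.congr_fun (hlμ x y) v
  have hr' x y v : r (C.mul x y) v = μ y (r x v) + μ x (r y v) := by simp [hr]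
  refine ⟨fun x y => ?_, fun x y z => ?_, fun x y z => ?_, fun x y z => ?_⟩
  · simp only [C.mul_comm' y x]
    abel
  · have hcomm a b v : μ a (μ b v) = μ b (μ a v) := by
      rw [← hμ', ← hμ', C.mul_comm']
    simp only [map_add, map_sub, hμ', C.mul_assoc', hcomm z]
    abel
  · have hN := congrArg N (C.pre_lie x y z)
    simp only [map_sub] at hN
    simp only [map_add, map_sub]
    linear_combination (norm := module) hl' x y (N z) + hlr' x z (N y) - hlr' y z (N x) - hN
  · simp only [map_add, map_sub, C.compat, hlμ', hr']
    abel
end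

section
/- Let j : Â → A be an abelian extension of Com-PreLie algebras with V = ker j, and let s : A → Â be a section of j. Then for every x ∈ A and u ∈ V, the elements s(x) ∗ u, s(x) • u, and u • s(x) all lie in V, and the maps μ(x)u := s(x) ∗ u, l(x)u := s(x) • u, r(x)u := u • s(x) make (V, μ, l, r) a representation of the Com-PreLie algebra A. -/
universe u

variable (k : Type u) [Field k] [CharZero k]

variable {A B B' V : Type*}
  [AddCommGroup A] [Module k A] [AddCommGroup B] [Module k B]
  [AddCommGroup B'] [Module k B'] [AddCommGroup V] [Module k V]

/-- In an abelian extension, the products of an element `b` with an element of the kernel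
depend only on the image of `b`. -/
theorem IsAbelianExtension.products_congr {CB : ComPreLie k B} {CA : ComPreLie k A}
    {j : B →ₗ[k] A} (hext : IsAbelianExtension k CB CA j) {b b' u : B}
    (hb : j b = j b') (hu : j u = 0) :
    CB.mul b u = CB.mul b' u ∧ CB.pre b u = CB.pre b' u ∧ CB.pre u b = CB.pre u b' := by
  have hd : j (b - b') = 0 := by rw [map_sub, hb, sub_self]
  obtain ⟨hmul, hpre⟩ := hext.2.2 _ _ hd hu
  have hpre' := (hext.2.2 _ _ hu hd).2
  rw [map_sub, LinearMap.sub_apply, sub_eq_zero] at hmul hpre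
  rw [map_sub, sub_eq_zero] at hpre'
  exact ⟨hmul, hpre, hpre'⟩

/-- for an abelian extension with section `s`, the operations
`μ(x)u = s(x)∗u`, `l(x)u = s(x)•u`, `r(x)u = u•s(x)` preserve `V = ker j` and make
`(V, μ, l, r)` a representation of `A`. -/
theorem statement2 (CB : ComPreLie k B) (CA : ComPreLie k A) (j : B →ₗ[k] A)
    (hext : IsAbelianExtension k CB CA j)
    (s : A →ₗ[k] B) (hs : ∀ x, j (s x) = x) :
    (∀ (x : A) (u : B), j u = 0 →
      j (CB.mul (s x) u) = 0 ∧ j (CB.pre (s x) u) = 0 ∧ j (CB.pre u (s x)) = 0) ∧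
    (∀ (x y : A) (u : B), j u = 0 →
      CB.mul (s (CA.mul x y)) u = CB.mul (s x) (CB.mul (s y) u)) ∧
    (∀ (x y : A) (u : B), j u = 0 →
      CB.pre (s (CA.pre x y)) u - CB.pre (s x) (CB.pre (s y) u)
        = CB.pre (s (CA.pre y x)) u - CB.pre (s y) (CB.pre (s x) u)) ∧
    (∀ (x y : A) (u : B), j u = 0 →
      CB.pre (CB.pre (s x) u) (s y) - CB.pre (s x) (CB.pre u (s y))
        = CB.pre (CB.pre u (s x)) (s y) - CB.pre u (s (CA.pre x y))) ∧
    (∀ (x y : A) (u : B), j u = 0 →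
      CB.pre (s x) (CB.mul (s y) u)
        = CB.mul (s (CA.pre x y)) u + CB.mul (s y) (CB.pre (s x) u)) ∧
    (∀ (x y : A) (u : B), j u = 0 →
      CB.pre u (s (CA.mul x y))
        = CB.mul (s y) (CB.pre u (s x)) + CB.mul (s x) (CB.pre u (s y))) := by
  have hmul (x y : A) : j (s (CA.mul x y)) = j (CB.mul (s x) (s y)) := by
    rw [hs, hext.2.1.1, hs, hs]
  have hpre (x y : A) : j (s (CA.pre x y)) = j (CB.pre (s x) (s y)) := by
    rw [hs, hext.2.1.2, hs, hs]
  refine ⟨fun x u hu => ?_, fun x y u hu => ?_, fun x y u hu => ?_, fun x y u hu => ?_,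
    fun x y u hu => ?_, fun x y u hu => ?_⟩
  · simp [hext.2.1.1, hext.2.1.2, hu]
  · rw [(hext.products_congr k (hmul x y) hu).1, CB.mul_assoc']
  · rw [(hext.products_congr k (hpre x y) hu).2.1, (hext.products_congr k (hpre y x) hu).2.1,
      CB.pre_lie]
  · rw [(hext.products_congr k (hpre x y) hu).2.2, CB.pre_lie]
  · rw [(hext.products_congr k (hpre x y) hu).1, CB.compat]
  · rw [(hext.products_congr k (hmul x y) hu).2.2, CB.compat, CB.mul_comm' _ (s y)]
end

section
/- Let j : Â → A be an abelian extension of Com-PreLie algebras with V = ker j and section s, and let (V, μ, l, r) be the induced representation (μ(x)u = s(x)∗u, l(x)u = s(x)•u, r(x)u = u•s(x)). Then the maps φ(x,y) := s(x) ∗ s(y) − s(x∗y) and ψ(x,y) := s(x) • s(y) − s(x•y) take values in V, φ is symmetric, and the pair (φ, ψ) is a 2-cocycle of A with coefficients in (V, μ, l, r). -/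
universe u

variable (k : Type u) [Field k] [CharZero k]

variable {A B B' V : Type*}
  [AddCommGroup A] [Module k A] [AddCommGroup B] [Module k B]
  [AddCommGroup B'] [Module k B'] [AddCommGroup V] [Module k V]

/-- the pair `(φ, ψ)` associated to a section `s` of an abelian
extension takes values in `V = ker j`, `φ` is symmetric, and `(φ, ψ)` is a
2-cocycle for the induced representation. -/
theorem statement4 (CB : ComPreLie k B) (CA : ComPreLie k A) (j : B →ₗ[k] A)
    (hext : IsAbelianExtension k CB CA j)
    (s : A →ₗ[k] B) (hs : ∀ x, j (s x) = x) :
    (∀ x y, j (extPhi k CB CA s x y) = 0) ∧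
    (∀ x y, j (extPsi k CB CA s x y) = 0) ∧
    (∀ x y, extPhi k CB CA s x y = extPhi k CB CA s y x) ∧
    (∀ x y z, extPhi k CB CA s x (CA.mul y z) + CB.mul (s x) (extPhi k CB CA s y z)
        - extPhi k CB CA s (CA.mul x y) z - CB.mul (s z) (extPhi k CB CA s x y) = 0) ∧
    (∀ x y z, extPsi k CB CA s (CA.pre x y) z + CB.pre (extPsi k CB CA s x y) (s z)
        - extPsi k CB CA s x (CA.pre y z) - CB.pre (s x) (extPsi k CB CA s y z)
        - extPsi k CB CA s (CA.pre y x) z - CB.pre (extPsi k CB CA s y x) (s z)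
        + extPsi k CB CA s y (CA.pre x z) + CB.pre (s y) (extPsi k CB CA s x z) = 0) ∧
    (∀ x y z, extPsi k CB CA s x (CA.mul y z) + CB.pre (s x) (extPhi k CB CA s y z)
        - extPhi k CB CA s (CA.pre x y) z - CB.mul (s z) (extPsi k CB CA s x y)
        - extPhi k CB CA s y (CA.pre x z) - CB.mul (s y) (extPsi k CB CA s x z) = 0) := by
  obtain ⟨-, ⟨jmul, jpre⟩, -⟩ := hext
  simp only [extPhi, extPsi, map_sub, LinearMap.sub_apply, jmul, jpre, hs, sub_self, implies_true,
    true_and]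
  refine ⟨fun x y => ?_, fun x y z => ?_, fun x y z => ?_, fun x y z => ?_⟩
  · rw [CB.mul_comm', CA.mul_comm']
  · rw [CA.mul_assoc', ← CB.mul_assoc' (s x), CB.mul_comm' (s z) (CB.mul _ _),
      CB.mul_comm' (s z) (s _)]
    abel
  · have hB := CB.pre_lie (s x) (s y) (s z)
    have hA := congrArg s (CA.pre_lie x y z)
    simp only [map_sub] at hA
    linear_combination (norm := abel) hB - hA
  · rw [CB.compat, CA.compat, map_add, CB.mul_comm' (s z) (CB.pre _ _), CB.mul_comm' (s z) (s _)]
    abel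
end

section
/- Let j : Â → A be an abelian extension of Com-PreLie algebras with V = ker j, and let s and s' be two sections of j with associated 2-cocycles (φ,ψ) and (φ',ψ') (where φ(x,y) = s(x)∗s(y) − s(x∗y), ψ(x,y) = s(x)•s(y) − s(x•y), and similarly for s'). Then (φ,ψ) and (φ',ψ') are cohomologous: the linear map f := s − s' takes values in V and satisfies φ(x,y) − φ'(x,y) = μ(x)f(y) − f(x∗y) + μ(y)f(x) and ψ(x,y) − ψ'(x,y) = l(x)f(y) − f(x•y) + r(y)f(x) for all x,y ∈ A, where (V,μ,l,r) is the induced representation. -/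
universe u

variable (k : Type u) [Field k] [CharZero k]

variable {A B B' V : Type*}
  [AddCommGroup A] [Module k A] [AddCommGroup B] [Module k B]
  [AddCommGroup B'] [Module k B'] [AddCommGroup V] [Module k V]

/-- First-order expansion of a difference of values of a bilinear map when the
second-order term vanishes. -/
theorem bilin_sub_bilin_eq {R M : Type*} [CommRing R] [AddCommGroup M] [Module R M]
    (m : M →ₗ[R] M →ₗ[R] M) {a a' b b' : M}
    (h : m (a - a') (b - b') = 0) :
    m a b - m a' b' = m a (b - b') + m (a - a') b := by
  simp only [map_sub, LinearMap.sub_apply] at h ⊢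
  rw [← sub_eq_zero, ← neg_eq_zero, ← h]
  abel

/-- the 2-cocycles associated to two sections `s, s'` of an abelian
extension are cohomologous via the map `f = s - s'` (which takes values in `V`). -/
theorem statement5 (CB : ComPreLie k B) (CA : ComPreLie k A) (j : B →ₗ[k] A)
    (hext : IsAbelianExtension k CB CA j)
    (s s' : A →ₗ[k] B) (hs : ∀ x, j (s x) = x) (hs' : ∀ x, j (s' x) = x) :
    (∀ x, j (s x - s' x) = 0) ∧
    (∀ x y, extPhi k CB CA s x y - extPhi k CB CA s' x y
        = CB.mul (s x) (s y - s' y) - (s (CA.mul x y) - s' (CA.mul x y))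
          + CB.mul (s y) (s x - s' x)) ∧
    (∀ x y, extPsi k CB CA s x y - extPsi k CB CA s' x y
        = CB.pre (s x) (s y - s' y) - (s (CA.pre x y) - s' (CA.pre x y))
          + CB.pre (s x - s' x) (s y)) := by
  have hf : ∀ x, j (s x - s' x) = 0 := fun x => by rw [map_sub, hs, hs', sub_self]
  refine ⟨hf, fun x y => ?_, fun x y => ?_⟩
  · have h := bilin_sub_bilin_eq CB.mul (hext.2.2 _ _ (hf x) (hf y)).1
    rw [extPhi, extPhi, sub_sub_sub_comm, h, CB.mul_comm' (s x - s' x)]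
    abel
  · have h := bilin_sub_bilin_eq CB.pre (hext.2.2 _ _ (hf x) (hf y)).2
    rw [extPsi, extPsi, sub_sub_sub_comm, h]
    abel
end

section
/- Let A be a Com-PreLie algebra, (V, μ, l, r) a representation of A, and (φ, ψ) a 2-cocycle of A with coefficients in V. Then the direct sum Â := A ⊕ V with products (x+u) ∗ (y+v) = x∗y + μ(x)v + μ(y)u + φ(x,y) and (x+u) • (y+v) = x•y + l(x)v + r(y)u + ψ(x,y) is a Com-PreLie algebra, and the projection j : Â → A, j(x+u) = x, is an abelian extension of A with kernel V. -/
universe u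

variable (k : Type u) [Field k] [CharZero k]

variable {A B B' V : Type*}
  [AddCommGroup A] [Module k A] [AddCommGroup B] [Module k B]
  [AddCommGroup B'] [Module k B'] [AddCommGroup V] [Module k V]

/-- The twisted bilinear product
`(x, u) (y, v) ↦ (m x y, a x v + b y u + c x y)` on `A × V`. -/
def twistedProduct (m : A →ₗ[k] A →ₗ[k] A) (a b : A →ₗ[k] Module.End k V)
    (c : A →ₗ[k] A →ₗ[k] V) : (A × V) →ₗ[k] (A × V) →ₗ[k] (A × V) :=
  LinearMap.mk₂ k (fun p q => (m p.1 q.1, a p.1 q.2 + b q.1 p.2 + c p.1 q.1))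
    (fun p p' q => by ext <;> simp; abel)
    (fun t p q => by ext <;> simp)
    (fun p q q' => by ext <;> simp; abel)
    (fun t p q => by ext <;> simp)

/-- a 2-cocycle `(φ, ψ)` gives `A ⊕ V` a Com-PreLie algebra structure
via the twisted products, and the projection onto `A` is an abelian extension of
`A` with kernel `V`. -/
theorem statement7 (C : ComPreLie k A) (μ l r : A →ₗ[k] Module.End k V)
    (hrep : IsRep k C μ l r) (φ ψ : A →ₗ[k] A →ₗ[k] V)
    (hcoc : IsTwoCocycle k C μ l r (fun x y => φ x y) (fun x y => ψ x y)) :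
    ∃ CB : ComPreLie k (A × V),
      (∀ p q : A × V, CB.mul p q = (C.mul p.1 q.1, μ p.1 q.2 + μ q.1 p.2 + φ p.1 q.1)) ∧
      (∀ p q : A × V, CB.pre p q = (C.pre p.1 q.1, l p.1 q.2 + r q.1 p.2 + ψ p.1 q.1)) ∧
      IsAbelianExtension k CB C (LinearMap.fst k A V) := by
  obtain ⟨hμ, hl, hr, hlμ, hrμ⟩ := hrep
  obtain ⟨hφ, hφφ, hψψ, hφψ⟩ := hcoc
  beta_reduce at hφ hφφ hψψ hφψ
  replace hμ x y v : μ (C.mul x y) v = μ x (μ y v) := LinearMap.congr_fun (hμ x y) v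
  replace hl x y v : l (C.pre x y) v - l x (l y v) = l (C.pre y x) v - l y (l x v) :=
    LinearMap.congr_fun (hl x y) v
  replace hr x y v : r y (l x v) - l x (r y v) = r y (r x v) - r (C.pre x y) v :=
    LinearMap.congr_fun (hr x y) v
  replace hlμ x y v : l x (μ y v) = μ (C.pre x y) v + μ y (l x v) :=
    LinearMap.congr_fun (hlμ x y) v
  replace hrμ x y v : r (C.mul x y) v = μ y (r x v) + μ x (r y v) :=
    LinearMap.congr_fun (hrμ x y) v
  have hμ_comm x y v : μ x (μ y v) = μ y (μ x v) := by
    rw [← hμ, C.mul_comm', hμ]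
  refine ⟨{ mul := twistedProduct k C.mul μ μ φ
            pre := twistedProduct k C.pre l r ψ
            mul_comm' := ?_
            mul_assoc' := ?_
            pre_lie := ?_
            compat := ?_ }, fun _ _ => rfl, fun _ _ => rfl, Prod.fst_surjective,
    ⟨fun _ _ => rfl, fun _ _ => rfl⟩, ?_⟩
  · rintro ⟨x, u⟩ ⟨y, v⟩
    ext
    · exact C.mul_comm' x y
    · simp only [twistedProduct, LinearMap.mk₂_apply]
      rw [hφ x y, add_comm (μ x v)]
  · rintro ⟨x, u⟩ ⟨y, v⟩ ⟨z, w⟩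
    ext
    · exact C.mul_assoc' x y z
    · simp only [twistedProduct, LinearMap.mk₂_apply, map_add, hμ]
      linear_combination (norm := abel) hμ_comm z x v + hμ_comm z y u - hφφ x y z
  · rintro ⟨x, u⟩ ⟨y, v⟩ ⟨z, w⟩
    ext
    · exact C.pre_lie x y z
    · simp only [twistedProduct, LinearMap.mk₂_apply, map_add, Prod.snd_sub]
      linear_combination (norm := abel) hl x y w + hr x z v - hr y z u + hψψ x y z
  · rintro ⟨x, u⟩ ⟨y, v⟩ ⟨z, w⟩
    ext
    · exact C.compat x y z
    · simp only [twistedProduct, LinearMap.mk₂_apply, map_add, Prod.snd_add]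
      linear_combination (norm := abel) hlμ x y w + hlμ x z v + hrμ y z u + hφψ x y z
  · rintro ⟨x, u⟩ ⟨y, v⟩ (rfl : x = 0) (rfl : y = 0)
    simp [twistedProduct]
end

section
/- Let A be a Com-PreLie algebra, (V, μ, l, r) a representation of A, and (φ, ψ), (φ', ψ') two cohomologous 2-cocycles with cohomology given by the linear map f : A → V (so φ(x,y) − φ'(x,y) = μ(x)f(y) − f(x∗y) + μ(y)f(x) and ψ(x,y) − ψ'(x,y) = l(x)f(y) − f(x•y) + r(y)f(x)). Then the linear map F : A ⊕ V → A ⊕ V defined by F(x+u) = x + u + f(x) is an isomorphism from the Com-PreLie algebra A ⊕ V twisted by (φ,ψ) to the Com-PreLie algebra A ⊕ V twisted by (φ',ψ'): F((x+u) ∗_φ (y+v)) = F(x+u) ∗_{φ'} F(y+v) and F((x+u) •_ψ (y+v)) = F(x+u) •_{ψ'} F(y+v), where (x+u) ∗_φ (y+v) = x∗y + μ(x)v + μ(y)u + φ(x,y) and (x+u) •_ψ (y+v) = x•y + l(x)v + r(y)u + ψ(x,y). -/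
universe u

variable (k : Type u) [Field k] [CharZero k]

variable {A B B' V : Type*}
  [AddCommGroup A] [Module k A] [AddCommGroup B] [Module k B]
  [AddCommGroup B'] [Module k B'] [AddCommGroup V] [Module k V]

/-- if two 2-cocycles are cohomologous via `f`, then
`F(x+u) = x + u + f(x)` is an isomorphism between the corresponding twisted
Com-PreLie structures on `A ⊕ V`. -/
theorem statement8 (C : ComPreLie k A) (μ l r : A →ₗ[k] Module.End k V)
    (hrep : IsRep k C μ l r) (φ ψ φ' ψ' : A → A → V)
    (hcoc : IsTwoCocycle k C μ l r φ ψ) (hcoc' : IsTwoCocycle k C μ l r φ' ψ')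
    (f : A →ₗ[k] V)
    (hphi : ∀ x y, φ x y - φ' x y = μ x (f y) - f (C.mul x y) + μ y (f x))
    (hpsi : ∀ x y, ψ x y - ψ' x y = l x (f y) - f (C.pre x y) + r y (f x))
    (F : A × V → A × V) (hF : ∀ p, F p = (p.1, p.2 + f p.1)) :
    Function.Bijective F ∧
    (∀ p q : A × V,
      F (C.mul p.1 q.1, μ p.1 q.2 + μ q.1 p.2 + φ p.1 q.1)
        = (C.mul (F p).1 (F q).1,
            μ (F p).1 (F q).2 + μ (F q).1 (F p).2 + φ' (F p).1 (F q).1)) ∧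
    (∀ p q : A × V,
      F (C.pre p.1 q.1, l p.1 q.2 + r q.1 p.2 + ψ p.1 q.1)
        = (C.pre (F p).1 (F q).1,
            l (F p).1 (F q).2 + r (F q).1 (F p).2 + ψ' (F p).1 (F q).1)) := by
  obtain rfl : F = fun p => (p.1, p.2 + f p.1) := funext hF
  refine ⟨Function.bijective_iff_has_inverse.mpr ⟨fun p => (p.1, p.2 - f p.1), ?_, ?_⟩, ?_, ?_⟩
  · intro p
    simp
  · intro p
    simp
  · intro p q
    refine Prod.ext rfl ?_
    simp only [map_add, sub_eq_iff_eq_add.mp (hphi p.1 q.1)]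
    abel
  · intro p q
    refine Prod.ext rfl ?_
    simp only [map_add, sub_eq_iff_eq_add.mp (hpsi p.1 q.1)]
    abel
end

section
/- Let j : Â → A be an abelian extension of Com-PreLie algebras with V = ker j, induced representation (V, μ, l, r), section s, and associated 2-cocycle (φ, ψ). Suppose γ is a Com-PreLie algebra automorphism of Â with γ(V) ⊆ V, let β := γ|_V and let α : A → A be the automorphism defined by α(x) = j(γ(s(x))). Then: (i) β(μ(x)u) = μ(α(x))β(u), β(l(x)u) = l(α(x))β(u), β(r(x)u) = r(α(x))β(u) for all x ∈ A, u ∈ V; and (ii) the linear map φ₀ := γ∘s − s∘α takes values in V and satisfies β(φ(x,y)) − φ(α(x),α(y)) = μ(α(x))φ₀(y) − φ₀(x∗y) + μ(α(y))φ₀(x) and β(ψ(x,y)) − ψ(α(x),α(y)) = l(α(x))φ₀(y) − φ₀(x•y) + r(α(y))φ₀(x) for all x, y ∈ A. -/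
universe u

variable (k : Type u) [Field k] [CharZero k]

variable {A B B' V : Type*}
  [AddCommGroup A] [Module k A] [AddCommGroup B] [Module k B]
  [AddCommGroup B'] [Module k B'] [AddCommGroup V] [Module k V]

/-- Expansion of a bilinear map when the two correction terms `a`, `b` multiply to zero. -/
theorem LinearMap.map_add_add_of_eq_zero {R M N P : Type*} [CommRing R]
    [AddCommGroup M] [Module R M] [AddCommGroup N] [Module R N] [AddCommGroup P] [Module R P]
    (m : M →ₗ[R] N →ₗ[R] P) {a : M} {b : N} (h : m a b = 0) (p : M) (q : N) :
    m (p + a) (q + b) = m p q + m p b + m a q := by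
  simp only [map_add, LinearMap.add_apply, h]
  abel

/-- necessity in the inducibility problem.  If `γ` is an
automorphism of the extension with `γ(V) ⊆ V`, `β := γ|_V`, `α := j ∘ γ ∘ s`,
then `(β, α)` is a compatible pair and `φ₀ := γ∘s - s∘α` takes values in `V` and
satisfies the two inducibility equations. -/
theorem statement9 (CB : ComPreLie k B) (CA : ComPreLie k A) (j : B →ₗ[k] A)
    (hext : IsAbelianExtension k CB CA j)
    (s : A →ₗ[k] B) (hs : ∀ x, j (s x) = x)
    (γ : B →ₗ[k] B) (hγbij : Function.Bijective γ) (hγhom : IsCPLHom k CB CB γ)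
    (hγV : ∀ u, j u = 0 → j (γ u) = 0)
    (α : A → A) (hα : ∀ x, α x = j (γ (s x)))
    (φ₀ : A → B) (hφ₀ : ∀ x, φ₀ x = γ (s x) - s (α x)) :
    (∀ (x : A) (u : B), j u = 0 →
        γ (CB.mul (s x) u) = CB.mul (s (α x)) (γ u) ∧
        γ (CB.pre (s x) u) = CB.pre (s (α x)) (γ u) ∧
        γ (CB.pre u (s x)) = CB.pre (γ u) (s (α x))) ∧
    (∀ x, j (φ₀ x) = 0) ∧
    (∀ x y, γ (extPhi k CB CA s x y) - extPhi k CB CA s (α x) (α y)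
        = CB.mul (s (α x)) (φ₀ y) - φ₀ (CA.mul x y) + CB.mul (s (α y)) (φ₀ x)) ∧
    (∀ x y, γ (extPsi k CB CA s x y) - extPsi k CB CA s (α x) (α y)
        = CB.pre (s (α x)) (φ₀ y) - φ₀ (CA.pre x y) + CB.pre (φ₀ x) (s (α y))) := by
  obtain ⟨-, ⟨hjm, hjp⟩, hab⟩ := hext
  obtain ⟨hγm, hγp⟩ := hγhom
  have hφV : ∀ x, j (φ₀ x) = 0 := fun x => by rw [hφ₀, map_sub, hs, hα, sub_self]
  have hγs : ∀ x, γ (s x) = s (α x) + φ₀ x := fun x => by rw [hφ₀]; abel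
  have hjγ : ∀ b, j (γ b) = α (j b) := fun b => by
    have h := hγV (b - s (j b)) (by rw [map_sub, hs, sub_self])
    rwa [map_sub, map_sub, sub_eq_zero, ← hα] at h
  have hαm : ∀ x y, α (CA.mul x y) = CA.mul (α x) (α y) := fun x y => by
    have h := hjγ (CB.mul (s x) (s y))
    rw [hγm, hjm, hjm, hs, hs, ← hα, ← hα] at h
    exact h.symm
  have hαp : ∀ x y, α (CA.pre x y) = CA.pre (α x) (α y) := fun x y => by
    have h := hjγ (CB.pre (s x) (s y))
    rw [hγp, hjp, hjp, hs, hs, ← hα, ← hα] at h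
    exact h.symm
  refine ⟨fun x u hu => ?_, hφV, fun x y => ?_, fun x y => ?_⟩
  · have h₁ := hab _ _ (hφV x) (hγV u hu)
    have h₂ := hab _ _ (hγV u hu) (hφV x)
    refine ⟨?_, ?_, ?_⟩
    · rw [hγm, hγs, map_add, LinearMap.add_apply, h₁.1, add_zero]
    · rw [hγp, hγs, map_add, LinearMap.add_apply, h₁.2, add_zero]
    · rw [hγp, hγs, map_add, h₂.2, add_zero]
  · have h := LinearMap.map_add_add_of_eq_zero CB.mul (hab _ _ (hφV x) (hφV y)).1
      (s (α x)) (s (α y))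
    simp only [extPhi, map_sub, hγm]
    rw [hγs x, hγs y, hγs (CA.mul x y), h, hαm, CB.mul_comm' (φ₀ x)]
    abel
  · have h := LinearMap.map_add_add_of_eq_zero CB.pre (hab _ _ (hφV x) (hφV y)).2
      (s (α x)) (s (α y))
    simp only [extPsi, map_sub, hγp]
    rw [hγs x, hγs y, hγs (CA.pre x y), h, hαp]
    abel
end

section
/- Let j : Â → A be an abelian extension of Com-PreLie algebras with V = ker j, induced representation (V, μ, l, r), section s, and associated 2-cocycle (φ, ψ). Let β be a Com-PreLie automorphism of V (equivalently a bijective linear map, since V has trivial products), α a Com-PreLie automorphism of A, and φ₀ : A → V a linear map such that: β(μ(x)u) = μ(α(x))β(u), β(l(x)u) = l(α(x))β(u), β(r(x)u) = r(α(x))β(u) for all x ∈ A, u ∈ V; β(φ(x,y)) − φ(α(x),α(y)) = μ(α(x))φ₀(y) − φ₀(x∗y) + μ(α(y))φ₀(x); and β(ψ(x,y)) − ψ(α(x),α(y)) = l(α(x))φ₀(y) − φ₀(x•y) + r(α(y))φ₀(x) for all x, y ∈ A. Then the linear map γ : Â → Â defined by γ(s(x) + u) = s(α(x)) + β(u) +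 φ₀(x) is a well-defined Com-PreLie algebra automorphism of Â with γ(V) ⊆ V, γ|_V = β, and j∘γ∘s = α. -/
universe u

variable (k : Type u) [Field k] [CharZero k]

variable {A B B' V : Type*}
  [AddCommGroup A] [Module k A] [AddCommGroup B] [Module k B]
  [AddCommGroup B'] [Module k B'] [AddCommGroup V] [Module k V]

/-- If `γ (s x + u) = s (α x) + β u + φ₀ x` on `j.ker`, and `β`, `φ₀` satisfy the equations relating
them to the bilinear product `P` lifting `p`, then `γ` preserves `P`. -/
theorem map_product_of_inducible {k A B : Type*} [Field k]
    [AddCommGroup A] [Module k A] [AddCommGroup B] [Module k B]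
    (P : B →ₗ[k] B →ₗ[k] B) (p : A →ₗ[k] A →ₗ[k] A) (j : B →ₗ[k] A)
    (hj : ∀ a b, j (P a b) = p (j a) (j b))
    (hker : ∀ u v, j u = 0 → j v = 0 → P u v = 0)
    (s : A →ₗ[k] B) (hs : ∀ x, j (s x) = x)
    (β : B →ₗ[k] B) (hβV : ∀ u, j u = 0 → j (β u) = 0)
    (α : A → A) (hα : ∀ x y, α (p x y) = p (α x) (α y))
    (hβl : ∀ x u, j u = 0 → β (P (s x) u) = P (s (α x)) (β u))
    (hβr : ∀ x u, j u = 0 → β (P u (s x)) = P (β u) (s (α x)))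
    (φ₀ : A → B) (hφ₀V : ∀ x, j (φ₀ x) = 0)
    (hθ : ∀ x y, β (P (s x) (s y) - s (p x y)) - (P (s (α x)) (s (α y)) - s (p (α x) (α y)))
      = P (s (α x)) (φ₀ y) - φ₀ (p x y) + P (φ₀ x) (s (α y)))
    (γ : B → B) (hγ : ∀ x u, j u = 0 → γ (s x + u) = s (α x) + β u + φ₀ x) (a b : B) :
    γ (P a b) = P (γ a) (γ b) := by
  have decomp : ∀ a, ∃ x u, j u = 0 ∧ a = s x + u :=
    fun a => ⟨j a, a - s (j a), by simp [hs], by abel⟩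
  obtain ⟨x, u, hu, rfl⟩ := decomp a
  obtain ⟨y, v, hv, rfl⟩ := decomp b
  have hP : P (s x + u) (s y + v)
      = s (p x y) + ((P (s x) (s y) - s (p x y)) + P (s x) v + P u (s y)) := by
    simp only [map_add, LinearMap.add_apply, hker u v hu hv]
    abel
  rw [hP, hγ x u hu, hγ y v hv, hγ _ _ (by simp [hj, hs, hu, hv]), map_add β, map_add β,
    hβl x v hv, hβr y u hu, eq_add_of_sub_eq (hθ x y), hα]
  simp only [map_add, LinearMap.add_apply, hker _ _ (hβV u hu) (hβV v hv),
    hker _ _ (hβV u hu) (hφ₀V y), hker _ _ (hφ₀V x) (hβV v hv), hker _ _ (hφ₀V x) (hφ₀V y)]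
  abel

/-- sufficiency in the inducibility problem.  Given a compatible
pair `(β, α)` and a linear map `φ₀ : A → V` satisfying the inducibility
equations, the map `γ(s(x) + u) = s(α(x)) + β(u) + φ₀(x)` is a Com-PreLie
automorphism of the total space with `γ(V) ⊆ V`, `γ|_V = β` and `j∘γ∘s = α`. -/
theorem statement10 (CB : ComPreLie k B) (CA : ComPreLie k A) (j : B →ₗ[k] A)
    (hext : IsAbelianExtension k CB CA j)
    (s : A →ₗ[k] B) (hs : ∀ x, j (s x) = x)
    (β : B →ₗ[k] B) (hβV : ∀ u, j u = 0 → j (β u) = 0)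
    (hβinj : ∀ u, j u = 0 → β u = 0 → u = 0)
    (hβsurj : ∀ u, j u = 0 → ∃ v, j v = 0 ∧ β v = u)
    (α : A ≃ₗ[k] A)
    (hαmul : ∀ x y, α (CA.mul x y) = CA.mul (α x) (α y))
    (hαpre : ∀ x y, α (CA.pre x y) = CA.pre (α x) (α y))
    (hβμ : ∀ (x : A) (u : B), j u = 0 → β (CB.mul (s x) u) = CB.mul (s (α x)) (β u))
    (hβl : ∀ (x : A) (u : B), j u = 0 → β (CB.pre (s x) u) = CB.pre (s (α x)) (β u))
    (hβr : ∀ (x : A) (u : B), j u = 0 → β (CB.pre u (s x)) = CB.pre (β u) (s (α x)))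
    (φ₀ : A →ₗ[k] B) (hφ₀V : ∀ x, j (φ₀ x) = 0)
    (hphi : ∀ x y, β (extPhi k CB CA s x y) - extPhi k CB CA s (α x) (α y)
        = CB.mul (s (α x)) (φ₀ y) - φ₀ (CA.mul x y) + CB.mul (s (α y)) (φ₀ x))
    (hpsi : ∀ x y, β (extPsi k CB CA s x y) - extPsi k CB CA s (α x) (α y)
        = CB.pre (s (α x)) (φ₀ y) - φ₀ (CA.pre x y) + CB.pre (φ₀ x) (s (α y)))
    (γ : B → B) (hγ : ∀ (x : A) (u : B), j u = 0 → γ (s x + u) = s (α x) + β u + φ₀ x) :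
    (∀ a b : B, γ (a + b) = γ a + γ b) ∧
    (∀ (c : k) (a : B), γ (c • a) = c • γ a) ∧
    Function.Bijective γ ∧
    (∀ a b : B, γ (CB.mul a b) = CB.mul (γ a) (γ b)) ∧
    (∀ a b : B, γ (CB.pre a b) = CB.pre (γ a) (γ b)) ∧
    (∀ u, j u = 0 → j (γ u) = 0) ∧
    (∀ u, j u = 0 → γ u = β u) ∧
    (∀ x, j (γ (s x)) = α x) := by
  obtain ⟨-, ⟨hjmul, hjpre⟩, hker⟩ := hext
  have hform : ∀ a, γ a = s (α (j a)) + β (a - s (j a)) + φ₀ (j a) := fun a => by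
    rw [← hγ _ _ (by simp [hs]), add_sub_cancel]
  have hjγ : ∀ a, j (γ a) = α (j a) := fun a => by
    rw [hform, map_add, map_add, hs, hφ₀V, hβV _ (by simp [hs])]
    simp
  have hγβ : ∀ u, j u = 0 → γ u = β u := fun u hu => by simp [hform, hu]
  have hadd : ∀ a b, γ (a + b) = γ a + γ b := fun a b => by
    simp only [hform, map_add, map_sub]
    abel
  refine ⟨hadd, fun c a => ?_, ⟨?_, fun b => ?_⟩, ?_, ?_, fun u hu => ?_, hγβ, fun x => ?_⟩
  · simp only [hform, map_smul, map_sub, smul_add, smul_sub]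
  · refine (injective_iff_map_eq_zero (AddMonoidHom.mk' γ hadd)).2 fun a (ha : γ a = 0) => ?_
    have hja : j a = 0 := by simpa [ha] using (hjγ a).symm
    exact hβinj a hja (by rw [← hγβ a hja, ha])
  · obtain ⟨v, hv, hβv⟩ := hβsurj (b - s (j b) - φ₀ (α.symm (j b))) (by simp [hs, hφ₀V])
    refine ⟨s (α.symm (j b)) + v, ?_⟩
    rw [hγ _ _ hv, hβv, α.apply_symm_apply]
    abel
  · refine map_product_of_inducible CB.mul CA.mul j hjmul (fun u v hu hv => (hker u v hu hv).1)
      s hs β hβV α hαmul hβμ (fun x u hu => ?_) φ₀ hφ₀V (fun x y => ?_) γ hγ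
    · rw [CB.mul_comm', hβμ x u hu, CB.mul_comm']
    · rw [CB.mul_comm' (φ₀ x)]
      exact hphi x y
  · exact map_product_of_inducible CB.pre CA.pre j hjpre (fun u v hu hv => (hker u v hu hv).2)
      s hs β hβV α hαpre hβl hβr φ₀ hφ₀V hpsi γ hγ
  · rw [hjγ, hu, map_zero]
  · rw [hjγ, hs]
end

section
/- Let A be a Com-PreLie algebra, (V, μ, l, r) a representation of A, and (φ, ψ) a 2-cocycle of A with coefficients in V. Let β be a bijective linear map on V and α a Com-PreLie automorphism of A forming a compatible pair, i.e., β(μ(x)u) = μ(α(x))β(u), β(l(x)u) = l(α(x))β(u), and β(r(x)u) = r(α(x))β(u) for all x ∈ A, u ∈ V. Then the pair (φ_{(β,α)}, ψ_{(β,α)}) defined by φ_{(β,α)}(x,y) := β(φ(α⁻¹(x), α⁻¹(y))) and ψ_{(β,α)}(x,y) := β(ψ(α⁻¹(x), α⁻¹(y))) is again a 2-cocycle of A with coefficients in (V, μ, l, r). -/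
universe u

variable (k : Type u) [Field k] [CharZero k]

variable {A B B' V : Type*}
  [AddCommGroup A] [Module k A] [AddCommGroup B] [Module k B]
  [AddCommGroup B'] [Module k B'] [AddCommGroup V] [Module k V]

/-- for a compatible pair `(β, α)`, the transported pair
`(φ_{(β,α)}, ψ_{(β,α)})` is again a 2-cocycle. -/
theorem statement11 (C : ComPreLie k A) (μ l r : A →ₗ[k] Module.End k V)
    (hrep : IsRep k C μ l r) (φ ψ : A → A → V)
    (hcoc : IsTwoCocycle k C μ l r φ ψ)
    (β : V ≃ₗ[k] V) (α : A ≃ₗ[k] A)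
    (hαmul : ∀ x y, α (C.mul x y) = C.mul (α x) (α y))
    (hαpre : ∀ x y, α (C.pre x y) = C.pre (α x) (α y))
    (hβμ : ∀ x u, β (μ x u) = μ (α x) (β u))
    (hβl : ∀ x u, β (l x u) = l (α x) (β u))
    (hβr : ∀ x u, β (r x u) = r (α x) (β u)) :
    IsTwoCocycle k C μ l r
      (fun x y => β (φ (α.symm x) (α.symm y)))
      (fun x y => β (ψ (α.symm x) (α.symm y))) := by
  obtain ⟨hsymm, hmul, hpre, hcompat⟩ := hcoc
  refine ⟨fun x y => congrArg β (hsymm _ _), fun x y z => ?_, fun x y z => ?_, fun x y z => ?_⟩ <;>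
    obtain ⟨x, rfl⟩ := α.surjective x <;>
    obtain ⟨y, rfl⟩ := α.surjective y <;>
    obtain ⟨z, rfl⟩ := α.surjective z <;>
    simp only [← hαmul, ← hαpre, LinearEquiv.symm_apply_apply, ← hβμ, ← hβl, ← hβr,
      ← map_add, ← map_sub]
  · rw [hmul, map_zero]
  · rw [hpre, map_zero]
  · rw [hcompat, map_zero]
end

section
/- Let j : Â → A be an abelian extension of Com-PreLie algebras with V = ker j and induced representation (V, μ, l, r). Let s and s' be two sections of j with associated 2-cocycles (φ, ψ) and (φ', ψ') respectively, and let (β, α) be a compatible pair (β a bijective linear map on V, α a Com-PreLie automorphism of A, with β(μ(x)u) = μ(α(x))β(u), β(l(x)u) = l(α(x))β(u), β(r(x)u) = r(α(x))β(u)). Then the 2-cocycles (φ_{(β,α)} − φ, ψ_{(β,α)} − ψ) and (φ'_{(β,α)} − φ', ψ'_{(β,α)} − ψ') are cohomologous, the cohomology being given by the linear map β∘φ₀∘α⁻¹ − φ₀, where φ₀ := s − s' : A → V. In particular, the Wells map W(β,α) := [(φ,ψ)^{(β,α)} − (φ,ψ)] ∈ H²(A,V) does not depend on the choice of section. -/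
universe u

variable (k : Type u) [Field k] [CharZero k]

variable {A B B' V : Type*}
  [AddCommGroup A] [Module k A] [AddCommGroup B] [Module k B]
  [AddCommGroup B'] [Module k B'] [AddCommGroup V] [Module k V]

/-- The defects of two linear maps from being multiplicative differ by a coboundary,
provided products of values of their difference vanish. -/
theorem sub_defect_eq_coboundary {k A B : Type*} [Field k]
    [AddCommGroup A] [Module k A] [AddCommGroup B] [Module k B]
    (P : B →ₗ[k] B →ₗ[k] B) (p : A →ₗ[k] A →ₗ[k] A) (s s' : A →ₗ[k] B) (x y : A)
    (h : P (s x - s' x) (s y - s' y) = 0) :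
    (P (s x) (s y) - s (p x y)) - (P (s' x) (s' y) - s' (p x y))
      = P (s x) (s y - s' y) - (s (p x y) - s' (p x y)) + P (s x - s' x) (s y) := by
  simp only [map_sub, LinearMap.sub_apply] at h ⊢
  linear_combination (norm := abel) -h

/-- The differences between the `(β, α)`-twisted defect and the defect of two sections differ
by the coboundary of `β ∘ (s - s') ∘ α⁻¹ - (s - s')`. -/
theorem twisted_sub_defect_eq_coboundary {k A B : Type*} [Field k]
    [AddCommGroup A] [Module k A] [AddCommGroup B] [Module k B]
    (P : B →ₗ[k] B →ₗ[k] B) (p : A →ₗ[k] A →ₗ[k] A) (j : B →ₗ[k] A)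
    (hP : ∀ u v, j u = 0 → j v = 0 → P u v = 0)
    (s s' : A →ₗ[k] B) (hs : ∀ x, j (s x) = x) (hs' : ∀ x, j (s' x) = x)
    (β : B →ₗ[k] B) (α : A ≃ₗ[k] A) (hα : ∀ x y, α (p x y) = p (α x) (α y))
    (hβl : ∀ x u, j u = 0 → β (P (s x) u) = P (s (α x)) (β u))
    (hβr : ∀ x u, j u = 0 → β (P u (s x)) = P (β u) (s (α x)))
    (g : A → B)
    (hg : ∀ x, g x = β (s (α.symm x) - s' (α.symm x)) - (s x - s' x)) (x y : A) :
    (β (P (s (α.symm x)) (s (α.symm y)) - s (p (α.symm x) (α.symm y)))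
          - (P (s x) (s y) - s (p x y)))
        - (β (P (s' (α.symm x)) (s' (α.symm y)) - s' (p (α.symm x) (α.symm y)))
          - (P (s' x) (s' y) - s' (p x y)))
      = P (s x) (g y) - g (p x y) + P (g x) (s y) := by
  have hd : ∀ z, j (s z - s' z) = 0 := fun z => by rw [map_sub, hs, hs', sub_self]
  have hαs : α.symm (p x y) = p (α.symm x) (α.symm y) := by
    rw [LinearEquiv.symm_apply_eq, hα, α.apply_symm_apply, α.apply_symm_apply]
  have e := sub_defect_eq_coboundary P p s s' x y (hP _ _ (hd x) (hd y))
  have e' := congrArg β (sub_defect_eq_coboundary P p s s' (α.symm x) (α.symm y)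
    (hP _ _ (hd _) (hd _)))
  rw [β.map_sub (_ - _) (_ - _), map_add, β.map_sub _ (_ - _), hβl _ _ (hd _), hβr _ _ (hd _),
    α.apply_symm_apply, α.apply_symm_apply] at e'
  rw [sub_sub_sub_comm, e, e', hg, hg, hg, hαs, (P (s x)).map_sub (β _), P.map_sub (β _),
    LinearMap.sub_apply]
  abel

/-- the Wells map does not depend on the choice of section: for two
sections `s, s'` with associated 2-cocycles `(φ,ψ)`, `(φ',ψ')` and a compatible
pair `(β, α)`, the differences `(φ_{(β,α)} - φ, ψ_{(β,α)} - ψ)` and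
`(φ'_{(β,α)} - φ', ψ'_{(β,α)} - ψ')` are cohomologous via
`g = β∘φ₀∘α⁻¹ - φ₀`, where `φ₀ = s - s'`. -/
theorem statement13 (CB : ComPreLie k B) (CA : ComPreLie k A) (j : B →ₗ[k] A)
    (hext : IsAbelianExtension k CB CA j)
    (s s' : A →ₗ[k] B) (hs : ∀ x, j (s x) = x) (hs' : ∀ x, j (s' x) = x)
    (β : B →ₗ[k] B) (hβV : ∀ u, j u = 0 → j (β u) = 0)
    (α : A ≃ₗ[k] A)
    (hαmul : ∀ x y, α (CA.mul x y) = CA.mul (α x) (α y))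
    (hαpre : ∀ x y, α (CA.pre x y) = CA.pre (α x) (α y))
    (hβμ : ∀ (x : A) (u : B), j u = 0 → β (CB.mul (s x) u) = CB.mul (s (α x)) (β u))
    (hβl : ∀ (x : A) (u : B), j u = 0 → β (CB.pre (s x) u) = CB.pre (s (α x)) (β u))
    (hβr : ∀ (x : A) (u : B), j u = 0 → β (CB.pre u (s x)) = CB.pre (β u) (s (α x)))
    (g : A → B)
    (hg : ∀ x, g x = β (s (α.symm x) - s' (α.symm x)) - (s x - s' x)) :
    ∀ x y,
      ((β (extPhi k CB CA s (α.symm x) (α.symm y)) - extPhi k CB CA s x y)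
          - (β (extPhi k CB CA s' (α.symm x) (α.symm y)) - extPhi k CB CA s' x y)
        = CB.mul (s x) (g y) - g (CA.mul x y) + CB.mul (s y) (g x)) ∧
      ((β (extPsi k CB CA s (α.symm x) (α.symm y)) - extPsi k CB CA s x y)
          - (β (extPsi k CB CA s' (α.symm x) (α.symm y)) - extPsi k CB CA s' x y)
        = CB.pre (s x) (g y) - g (CA.pre x y) + CB.pre (g x) (s y)) := by
  obtain ⟨-, -, hV⟩ := hext
  refine fun x y => ⟨?_, ?_⟩
  · rw [CB.mul_comm' (s y) (g x)]
    exact twisted_sub_defect_eq_coboundary CB.mul CA.mul j (fun u v hu hv => (hV u v hu hv).1)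
      s s' hs hs' β α hαmul hβμ
      (fun x u hu => by rw [CB.mul_comm', hβμ x u hu, CB.mul_comm']) g hg x y
  · exact twisted_sub_defect_eq_coboundary CB.pre CA.pre j (fun u v hu hv => (hV u v hu hv).2)
      s s' hs hs' β α hαpre hβl hβr g hg x y
end

section
/- Let j : Â → A be an abelian extension of Com-PreLie algebras with V = ker j, induced representation (V, μ, l, r), and section s. If γ is a Com-PreLie automorphism of Â with γ|_V = id_V and j∘γ∘s = id_A, then the linear map φ_γ := γ∘s − s takes values in V and is a 1-cocycle: μ(x)φ_γ(y) − φ_γ(x∗y) + μ(y)φ_γ(x) = 0 and l(x)φ_γ(y) − φ_γ(x•y) + r(y)φ_γ(x) = 0 for all x, y ∈ A. -/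
universe u

variable (k : Type u) [Field k] [CharZero k]

variable {A B B' V : Type*}
  [AddCommGroup A] [Module k A] [AddCommGroup B] [Module k B]
  [AddCommGroup B'] [Module k B'] [AddCommGroup V] [Module k V]

/-- If linear maps `j` and `γ` preserve a bilinear product that vanishes on `ker j`, `s` and `γ ∘ s`
are sections of `j`, and `γ` fixes `ker j`, then `γ ∘ s - s` is a derivation along `s`. -/
theorem sub_section_derivation (m : B →ₗ[k] B →ₗ[k] B) (p : A →ₗ[k] A →ₗ[k] A) (j : B →ₗ[k] A)
    (hj : ∀ x y, j (m x y) = p (j x) (j y)) (hm : ∀ u v, j u = 0 → j v = 0 → m u v = 0)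
    (s : A →ₗ[k] B) (hs : ∀ x, j (s x) = x) (γ : B →ₗ[k] B) (hγ : ∀ x y, γ (m x y) = m (γ x) (γ y))
    (hγV : ∀ u, j u = 0 → γ u = u) (hγs : ∀ x, j (γ (s x)) = x) (x y : A) :
    m (s x) (γ (s y) - s y) - (γ (s (p x y)) - s (p x y)) + m (γ (s x) - s x) (s y) = 0 := by
  have hker : γ (m (s x) (s y) - s (p x y)) = m (s x) (s y) - s (p x y) :=
    hγV _ (by simp [hj, hs])
  have hzero : m (γ (s x) - s x) (γ (s y) - s y) = 0 := hm _ _ (by simp [hs, hγs]) (by simp [hs, hγs])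
  simp only [map_sub, LinearMap.sub_apply, hγ] at hker hzero ⊢
  grind

/-- if `γ` is an automorphism of the extension inducing the
identity on both `V` and `A`, then `φ_γ := γ∘s - s` takes values in `V` and is a
1-cocycle. -/
theorem statement14 (CB : ComPreLie k B) (CA : ComPreLie k A) (j : B →ₗ[k] A)
    (hext : IsAbelianExtension k CB CA j)
    (s : A →ₗ[k] B) (hs : ∀ x, j (s x) = x)
    (γ : B →ₗ[k] B) (hγbij : Function.Bijective γ) (hγhom : IsCPLHom k CB CB γ)
    (hγV : ∀ u, j u = 0 → γ u = u) (hγs : ∀ x, j (γ (s x)) = x) :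
    (∀ x, j (γ (s x) - s x) = 0) ∧
    (∀ x y, CB.mul (s x) (γ (s y) - s y) - (γ (s (CA.mul x y)) - s (CA.mul x y))
        + CB.mul (s y) (γ (s x) - s x) = 0) ∧
    (∀ x y, CB.pre (s x) (γ (s y) - s y) - (γ (s (CA.pre x y)) - s (CA.pre x y))
        + CB.pre (γ (s x) - s x) (s y) = 0) := by
  obtain ⟨-, ⟨hmul, hpre⟩, hV⟩ := hext
  refine ⟨fun x => by simp [hs, hγs], fun x y => ?_, fun x y => ?_⟩
  · rw [CB.mul_comm' (s y)]
    exact sub_section_derivation k CB.mul CA.mul j hmul (fun u v hu hv => (hV u v hu hv).1)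
      s hs γ hγhom.1 hγV hγs x y
  · exact sub_section_derivation k CB.pre CA.pre j hpre (fun u v hu hv => (hV u v hu hv).2)
      s hs γ hγhom.2 hγV hγs x y
end

section
/- Let j : Â → A be an abelian extension of Com-PreLie algebras with V = ker j, induced representation (V, μ, l, r), and section s. If N : A → V is a 1-cocycle (i.e., μ(x)N(y) − N(x∗y) + μ(y)N(x) = 0 and l(x)N(y) − N(x•y) + r(y)N(x) = 0 for all x,y ∈ A), then the linear map γ : Â → Â defined by γ(s(x) + u) = s(x) + N(x) + u (for x ∈ A, u ∈ V) is a Com-PreLie automorphism of Â satisfying γ|_V = id_V and j∘γ∘s = id_A. -/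
universe u

variable (k : Type u) [Field k] [CharZero k]

variable {A B B' V : Type*}
  [AddCommGroup A] [Module k A] [AddCommGroup B] [Module k B]
  [AddCommGroup B'] [Module k B'] [AddCommGroup V] [Module k V]

/-- Let `m` be a bilinear product on `B` vanishing on `ker j` and lifting the product `p` on `A`.
If `N : A → ker j` is a derivation with respect to the actions through the section `s`, then
`b ↦ b + N (j b)` is multiplicative. -/
theorem add_comp_map_mul {R A B : Type*} [Ring R] [AddCommGroup A] [Module R A]
    [AddCommGroup B] [Module R B] {m : B → B → B} {p : A → A → A} {j : B →ₗ[R] A}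
    (hadd_left : ∀ a b c, m (a + b) c = m a c + m b c)
    (hadd_right : ∀ a b c, m a (b + c) = m a b + m a c)
    (hj : ∀ a b, j (m a b) = p (j a) (j b)) (hker : ∀ u v, j u = 0 → j v = 0 → m u v = 0)
    {s N : A →ₗ[R] B} (hs : ∀ x, j (s x) = x) (hNV : ∀ x, j (N x) = 0)
    (hN : ∀ x y, m (s x) (N y) - N (p x y) + m (N x) (s y) = 0) (a b : B) :
    m a b + N (j (m a b)) = m (a + N (j a)) (b + N (j b)) := by
  have hsub (a : B) : j (a - s (j a)) = 0 := by simp [hs]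
  have hl : m a (N (j b)) = m (s (j a)) (N (j b)) := by
    conv_lhs => rw [← sub_add_cancel a (s (j a))]
    rw [hadd_left, hker _ _ (hsub a) (hNV _), zero_add]
  have hr : m (N (j a)) b = m (N (j a)) (s (j b)) := by
    conv_lhs => rw [← sub_add_cancel b (s (j b))]
    rw [hadd_right, hker _ _ (hNV _) (hsub b), zero_add]
  have hder : N (p (j a) (j b)) = m (s (j a)) (N (j b)) + m (N (j a)) (s (j b)) := by
    rw [eq_comm, ← sub_eq_zero, ← hN (j a) (j b)]
    abel
  rw [hj, hder, hadd_left, hadd_right, hadd_right, hker _ _ (hNV _) (hNV _), hl, hr]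
  abel

/-- a 1-cocycle `N : A → V` gives rise to an automorphism
`γ(s(x) + u) = s(x) + N(x) + u` of the extension inducing the identity on both
`V` and `A`. -/
theorem statement15 (CB : ComPreLie k B) (CA : ComPreLie k A) (j : B →ₗ[k] A)
    (hext : IsAbelianExtension k CB CA j)
    (s : A →ₗ[k] B) (hs : ∀ x, j (s x) = x)
    (N : A →ₗ[k] B) (hNV : ∀ x, j (N x) = 0)
    (hN1 : ∀ x y, CB.mul (s x) (N y) - N (CA.mul x y) + CB.mul (s y) (N x) = 0)
    (hN2 : ∀ x y, CB.pre (s x) (N y) - N (CA.pre x y) + CB.pre (N x) (s y) = 0)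
    (γ : B → B) (hγ : ∀ (x : A) (u : B), j u = 0 → γ (s x + u) = s x + N x + u) :
    (∀ a b : B, γ (a + b) = γ a + γ b) ∧
    (∀ (c : k) (a : B), γ (c • a) = c • γ a) ∧
    Function.Bijective γ ∧
    (∀ a b : B, γ (CB.mul a b) = CB.mul (γ a) (γ b)) ∧
    (∀ a b : B, γ (CB.pre a b) = CB.pre (γ a) (γ b)) ∧
    (∀ u, j u = 0 → γ u = u) ∧
    (∀ x, j (γ (s x)) = x) := by
  obtain ⟨-, ⟨hmul, hpre⟩, hker⟩ := hext
  have hγ' (b : B) : γ b = b + N (j b) := by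
    have h := hγ (j b) (b - s (j b)) (by simp [hs])
    rw [add_sub_cancel] at h
    rw [h]
    abel
  simp only [hγ']
  refine ⟨fun a b => ?_, fun c a => ?_, ?_, ?_, ?_, fun u hu => ?_, fun x => ?_⟩
  · rw [map_add, map_add]
    abel
  · rw [map_smul, map_smul, smul_add]
  · refine Function.bijective_iff_has_inverse.2 ⟨fun b => b - N (j b), fun b => ?_, fun b => ?_⟩
    · simp [hγ', hNV]
    · simp [hγ', hNV]
  · refine add_comp_map_mul (p := fun x y => CA.mul x y) (fun a b c => by simp)
      (fun a b c => by simp) hmul (fun u v hu hv => (hker u v hu hv).1) hs hNV fun x y => ?_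
    rw [CB.mul_comm' (N x)]
    exact hN1 x y
  · exact add_comp_map_mul (p := fun x y => CA.pre x y) (fun a b c => by simp)
      (fun a b c => by simp) hpre (fun u v hu hv => (hker u v hu hv).2) hs hNV hN2
  · simp [hu]
  · simp [hs, hNV]
end

section
/- Let j : Â → A be an abelian extension of Com-PreLie algebras with V = ker j and section s. The map Ψ, sending a Com-PreLie automorphism γ of Â with γ|_V = id_V and j∘γ∘s = id_A to the 1-cocycle Ψ(γ) := γ∘s − s, is a group isomorphism from the group Aut_V^A(Â) of such automorphisms (under composition) onto the additive group Z¹(A,V) of 1-cocycles; in particular Ψ(γ∘γ') = Ψ(γ) + Ψ(γ') for all such γ, γ', and Ψ is bijective. -/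
universe u

variable (k : Type u) [Field k] [CharZero k]

variable {A B B' V : Type*}
  [AddCommGroup A] [Module k A] [AddCommGroup B] [Module k B]
  [AddCommGroup B'] [Module k B'] [AddCommGroup V] [Module k V]

/-- The group `Aut_V^A(Â)` of automorphisms of the extension inducing the
identity on both `V` and `A`. -/
def IsAutVA (CB : ComPreLie k B) (j : B →ₗ[k] A) (s : A →ₗ[k] B)
    (γ : B →ₗ[k] B) : Prop :=
  Function.Bijective γ ∧ IsCPLHom k CB CB γ ∧
  (∀ u, j u = 0 → γ u = u) ∧ (∀ x, j (γ (s x)) = x)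

/-- 1-cocycles of `A` with values in `V = ker j` (for the induced representation). -/
def IsOneCocycle (CB : ComPreLie k B) (CA : ComPreLie k A) (j : B →ₗ[k] A)
    (s : A →ₗ[k] B) (N : A → B) : Prop :=
  (∀ x, j (N x) = 0) ∧
  (∀ x y, CB.mul (s x) (N y) - N (CA.mul x y) + CB.mul (s y) (N x) = 0) ∧
  (∀ x y, CB.pre (s x) (N y) - N (CA.pre x y) + CB.pre (N x) (s y) = 0)

/-- An endomorphism of an extension that is the identity on the kernel is determined by its
values on a section. -/
theorem apply_eq_add_of_fixes_ker {R M E : Type*} [CommRing R] [AddCommGroup M] [Module R M]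
    [AddCommGroup E] [Module R E] {j : E →ₗ[R] M} {s : M →ₗ[R] E} (hs : ∀ x, j (s x) = x)
    {γ : E →ₗ[R] E} (hγ : ∀ u, j u = 0 → γ u = u) (b : E) :
    γ b = b + (γ (s (j b)) - s (j b)) := by
  have h := hγ (b - s (j b)) (by rw [map_sub, hs, sub_self])
  rw [map_sub, sub_eq_iff_eq_add] at h
  rw [h]
  abel

/-- For an abelian extension of bilinear products, the map `b ↦ b + N (j b)` is multiplicative
if and only if `N` is a derivation. -/
theorem map_bilin_iff_derivation {R M E : Type*} [CommRing R] [AddCommGroup M] [Module R M]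
    [AddCommGroup E] [Module R E] {j : E →ₗ[R] M} {s : M →ₗ[R] E} (hs : ∀ x, j (s x) = x)
    {m : E →ₗ[R] E →ₗ[R] E} {p : M →ₗ[R] M →ₗ[R] M} (hj : ∀ b c, j (m b c) = p (j b) (j c))
    (hV : ∀ u v, j u = 0 → j v = 0 → m u v = 0) {γ : E →ₗ[R] E} {N : M → E}
    (hN : ∀ x, j (N x) = 0) (hγ : ∀ b, γ b = b + N (j b)) :
    (∀ b c, γ (m b c) = m (γ b) (γ c)) ↔
      ∀ x y, m (s x) (N y) - N (p x y) + m (N x) (s y) = 0 := by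
  have expand (b c : E) : m (γ b) (γ c) - γ (m b c) =
      m (s (j b)) (N (j c)) - N (p (j b) (j c)) + m (N (j b)) (s (j c)) := by
    have hl := hV (b - s (j b)) (N (j c)) (by rw [map_sub, hs, sub_self]) (hN _)
    have hr := hV (N (j b)) (c - s (j c)) (hN _) (by rw [map_sub, hs, sub_self])
    rw [map_sub, LinearMap.sub_apply, sub_eq_zero] at hl
    rw [map_sub, sub_eq_zero] at hr
    rw [hγ b, hγ c, hγ (m b c), hj]
    simp only [map_add, LinearMap.add_apply, hV _ _ (hN _) (hN _), hl, hr]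
    abel
  constructor
  · intro h x y
    simpa [hs, h] using (expand (s x) (s y)).symm
  · intro h b c
    exact (sub_eq_zero.mp ((expand b c).trans (h _ _))).symm

/-- `Ψ(γ) := γ∘s - s` is a group isomorphism from `Aut_V^A(Â)`
(under composition) onto the additive group `Z¹(A, V)` of 1-cocycles: it takes
values in the 1-cocycles, sends composition to addition, and is bijective. -/
theorem statement16 (CB : ComPreLie k B) (CA : ComPreLie k A) (j : B →ₗ[k] A)
    (hext : IsAbelianExtension k CB CA j)
    (s : A →ₗ[k] B) (hs : ∀ x, j (s x) = x) :
    (∀ γ : B →ₗ[k] B, IsAutVA k CB j s γ →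
        IsOneCocycle k CB CA j s (fun x => γ (s x) - s x)) ∧
    (∀ γ γ' : B →ₗ[k] B, IsAutVA k CB j s γ → IsAutVA k CB j s γ' →
        ∀ x, γ (γ' (s x)) - s x = (γ (s x) - s x) + (γ' (s x) - s x)) ∧
    (∀ γ γ' : B →ₗ[k] B, IsAutVA k CB j s γ → IsAutVA k CB j s γ' →
        (∀ x, γ (s x) - s x = γ' (s x) - s x) → γ = γ') ∧
    (∀ N : A →ₗ[k] B, IsOneCocycle k CB CA j s (fun x => N x) →
        ∃ γ : B →ₗ[k] B, IsAutVA k CB j s γ ∧ ∀ x, γ (s x) - s x = N x) := by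
  obtain ⟨-, ⟨hmul, hpre⟩, hV⟩ := hext
  have fixes {γ : B →ₗ[k] B} (hγ : IsAutVA k CB j s γ) :=
    apply_eq_add_of_fixes_ker hs hγ.2.2.1
  have diff_ker {γ : B →ₗ[k] B} (hγ : IsAutVA k CB j s γ) (x : A) :
      j (γ (s x) - s x) = 0 := by
    rw [map_sub, hγ.2.2.2, hs, sub_self]
  refine ⟨fun γ hγ => ⟨diff_ker hγ, fun x y => ?_, ?_⟩, fun γ γ' hγ hγ' x => ?_,
    fun γ γ' hγ hγ' h => ?_, fun N ⟨hN, hNmul, hNpre⟩ => ?_⟩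
  · rw [CB.mul_comm' (s y)]
    exact (map_bilin_iff_derivation (N := fun x => γ (s x) - s x) hs hmul
      (fun u v hu hv => (hV u v hu hv).1) (diff_ker hγ) (fixes hγ)).1 hγ.2.1.1 x y
  · exact (map_bilin_iff_derivation (N := fun x => γ (s x) - s x) hs hpre
      (fun u v hu hv => (hV u v hu hv).2) (diff_ker hγ) (fixes hγ)).1 hγ.2.1.2
  · rw [fixes hγ (γ' (s x)), hγ'.2.2.2]
    abel
  · ext b
    rw [fixes hγ b, fixes hγ' b, h]
  · have j_shift (b : B) : j (b + N (j b)) = j b := by rw [map_add, hN, add_zero]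
    refine ⟨LinearMap.id + N ∘ₗ j, ⟨⟨fun b c h => ?_, fun b => ⟨b - N (j b), ?_⟩⟩,
      ⟨?_, ?_⟩, fun u hu => by simp [hu], fun x => by simpa [hs] using hN x⟩,
      fun x => by simp [hs]⟩
    · have h' : b + N (j b) = c + N (j c) := h
      have hjbc : j b = j c := by rw [← j_shift b, h', j_shift]
      rw [hjbc] at h'
      exact add_right_cancel h'
    · have hj : j (b - N (j b)) = j b := by rw [map_sub, hN, sub_zero]
      simp only [LinearMap.add_apply, LinearMap.id_apply, LinearMap.comp_apply, hj,
        sub_add_cancel]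
    · refine (map_bilin_iff_derivation (N := N) hs hmul (fun u v hu hv => (hV u v hu hv).1) hN
        fun _ => rfl).2 fun x y => ?_
      rw [CB.mul_comm' (N x)]
      exact hNmul x y
    · exact (map_bilin_iff_derivation (N := N) hs hpre (fun u v hu hv => (hV u v hu hv).2) hN
        fun _ => rfl).2 hNpre
end

section
/- Let j : Â → A be an abelian extension of Com-PreLie algebras with V = ker j, induced representation (V, μ, l, r), section s, and associated 2-cocycle (φ, ψ). Let (β, α) be a compatible pair (β ∈ Aut(V), α a Com-PreLie automorphism of A, with β(μ(x)u) = μ(α(x))β(u), β(l(x)u) = l(α(x))β(u), β(r(x)u) = r(α(x))β(u) for all x ∈ A, u ∈ V). Then there exists a Com-PreLie automorphism γ of Â with γ(V) ⊆ V, γ|_V = β and j∘γ∘s = α if and only if the 2-cocycles (φ_{(β,α)}, ψ_{(β,α)}) and (φ, ψ) are cohomologous, where φ_{(β,α)}(x,y) = β(φ(α⁻¹(x),α⁻¹(y))) and ψ_{(β,α)}(x,y) = β(ψ(α⁻¹(x),α⁻¹(y))). -/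
universe u

variable (k : Type u) [Field k] [CharZero k]

variable {A B B' V : Type*}
  [AddCommGroup A] [Module k A] [AddCommGroup B] [Module k B]
  [AddCommGroup B'] [Module k B'] [AddCommGroup V] [Module k V]

/-- A linear map `γ` of an extension which restricts to `β` on the kernel and sends `s x` to
`s (α x) + f (α x)` preserves a product `m` iff `f` is a coboundary between the twisted
cocycle and the cocycle of `m`. -/
theorem preserves_product_iff {K A B : Type*} [Field K] [AddCommGroup A] [Module K A]
    [AddCommGroup B] [Module K B]
    (m : B →ₗ[K] B →ₗ[K] B) (n : A →ₗ[K] A →ₗ[K] A) (j : B →ₗ[K] A)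
    (hj : ∀ x y, j (m x y) = n (j x) (j y))
    (hsq : ∀ u v, j u = 0 → j v = 0 → m u v = 0)
    (s : A →ₗ[K] B) (hs : ∀ x, j (s x) = x)
    (β : B →ₗ[K] B) (hβV : ∀ u, j u = 0 → j (β u) = 0)
    (α : A ≃ₗ[K] A) (hα : ∀ x y, α (n x y) = n (α x) (α y))
    (hβl : ∀ (x : A) (u : B), j u = 0 → β (m (s x) u) = m (s (α x)) (β u))
    (hβr : ∀ (x : A) (u : B), j u = 0 → β (m u (s x)) = m (β u) (s (α x)))
    (f : A →ₗ[K] B) (hf : ∀ x, j (f x) = 0)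
    (γ : B →ₗ[K] B) (hγV : ∀ u, j u = 0 → γ u = β u)
    (hγs : ∀ x, γ (s x) = s (α x) + f (α x)) :
    (∀ x y, γ (m x y) = m (γ x) (γ y)) ↔
    ∀ x y, β (m (s (α.symm x)) (s (α.symm y)) - s (n (α.symm x) (α.symm y)))
        - (m (s x) (s y) - s (n x y)) = m (s x) (f y) - f (n x y) + m (f x) (s y) := by
  have key (a b : A) : γ (m (s a) (s b)) =
      β (m (s a) (s b) - s (n a b)) + s (n (α a) (α b)) + f (n (α a) (α b)) := by
    rw [← hγV _ (by simp [hj, hs]), map_sub, hγs, hα]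
    abel
  have expand (x y : A) : m (s x + f x) (s y + f y) =
      m (s x) (s y) + m (s x) (f y) + m (f x) (s y) := by
    simp only [map_add, LinearMap.add_apply, hsq _ _ (hf x) (hf y)]
    abel
  constructor
  · intro h x y
    have h1 := h (s (α.symm x)) (s (α.symm y))
    simp only [key, hγs, LinearEquiv.apply_symm_apply, expand] at h1
    rw [← sub_eq_zero] at h1 ⊢
    rw [← h1]
    abel
  · intro h
    have hss (a b : A) : γ (m (s a) (s b)) = m (γ (s a)) (γ (s b)) := by
      have h1 := h (α a) (α b)
      simp only [LinearEquiv.symm_apply_apply] at h1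
      rw [key, hγs, hγs, expand]
      rw [← sub_eq_zero] at h1 ⊢
      rw [← h1]
      abel
    have hsu (a : A) (u : B) (hu : j u = 0) : γ (m (s a) u) = m (γ (s a)) (γ u) := by
      rw [hγV _ (by simp [hj, hu]), hβl a u hu, hγs, hγV u hu, map_add, LinearMap.add_apply,
        hsq _ _ (hf _) (hβV u hu), add_zero]
    have hus (u : B) (a : A) (hu : j u = 0) : γ (m u (s a)) = m (γ u) (γ (s a)) := by
      rw [hγV _ (by simp [hj, hu]), hβr a u hu, hγs, hγV u hu, map_add,
        hsq _ _ (hβV u hu) (hf _), add_zero]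
    have huu (u v : B) (hu : j u = 0) (hv : j v = 0) : γ (m u v) = m (γ u) (γ v) := by
      rw [hsq u v hu hv, hγV u hu, hγV v hv, hsq _ _ (hβV u hu) (hβV v hv), map_zero]
    intro x y
    have split (b : B) : ∃ a u, j u = 0 ∧ b = s a + u :=
      ⟨j b, b - s (j b), by simp [hs], by abel⟩
    obtain ⟨a, u, hu, rfl⟩ := split x
    obtain ⟨b, v, hv, rfl⟩ := split y
    simp only [map_add, LinearMap.add_apply, hss, hsu _ _ hv, hus _ _ hu, huu _ _ hu hv]

/-- a compatible pair `(β, α)` is inducible (lifts to an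
automorphism `γ` of the extension with `γ(V) ⊆ V`, `γ|_V = β`, `j∘γ∘s = α`) if
and only if the 2-cocycles `(φ_{(β,α)}, ψ_{(β,α)})` and `(φ, ψ)` are
cohomologous. -/
theorem statement18 (CB : ComPreLie k B) (CA : ComPreLie k A) (j : B →ₗ[k] A)
    (hext : IsAbelianExtension k CB CA j)
    (s : A →ₗ[k] B) (hs : ∀ x, j (s x) = x)
    (β : B →ₗ[k] B) (hβV : ∀ u, j u = 0 → j (β u) = 0)
    (hβinj : ∀ u, j u = 0 → β u = 0 → u = 0)
    (hβsurj : ∀ u, j u = 0 → ∃ v, j v = 0 ∧ β v = u)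
    (α : A ≃ₗ[k] A)
    (hαmul : ∀ x y, α (CA.mul x y) = CA.mul (α x) (α y))
    (hαpre : ∀ x y, α (CA.pre x y) = CA.pre (α x) (α y))
    (hβμ : ∀ (x : A) (u : B), j u = 0 → β (CB.mul (s x) u) = CB.mul (s (α x)) (β u))
    (hβl : ∀ (x : A) (u : B), j u = 0 → β (CB.pre (s x) u) = CB.pre (s (α x)) (β u))
    (hβr : ∀ (x : A) (u : B), j u = 0 → β (CB.pre u (s x)) = CB.pre (β u) (s (α x))) :
    (∃ γ : B →ₗ[k] B, Function.Bijective γ ∧ IsCPLHom k CB CB γ ∧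
        (∀ u, j u = 0 → j (γ u) = 0) ∧
        (∀ u, j u = 0 → γ u = β u) ∧
        (∀ x, j (γ (s x)) = α x)) ↔
    (∃ f : A →ₗ[k] B, (∀ x, j (f x) = 0) ∧
        (∀ x y, β (extPhi k CB CA s (α.symm x) (α.symm y)) - extPhi k CB CA s x y
            = CB.mul (s x) (f y) - f (CA.mul x y) + CB.mul (s y) (f x)) ∧
        (∀ x y, β (extPsi k CB CA s (α.symm x) (α.symm y)) - extPsi k CB CA s x y
            = CB.pre (s x) (f y) - f (CA.pre x y) + CB.pre (f x) (s y))) := by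
  obtain ⟨-, ⟨hjmul, hjpre⟩, hsq⟩ := hext
  have hβμ' (x : A) (u : B) (hu : j u = 0) :
      β (CB.mul u (s x)) = CB.mul (β u) (s (α x)) := by
    rw [CB.mul_comm', hβμ x u hu, CB.mul_comm']
  have hmul := preserves_product_iff CB.mul CA.mul j hjmul (fun u v hu hv => (hsq u v hu hv).1)
    s hs β hβV α hαmul hβμ hβμ'
  have hpre := preserves_product_iff CB.pre CA.pre j hjpre (fun u v hu hv => (hsq u v hu hv).2)
    s hs β hβV α hαpre hβl hβr
  constructor
  · rintro ⟨γ, -, ⟨hγmul, hγpre⟩, -, hγV, hγs⟩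
    let f : A →ₗ[k] B := γ ∘ₗ s ∘ₗ α.symm.toLinearMap - s
    have hf (x : A) : j (f x) = 0 := by simp [f, hγs, hs]
    have hγf (x : A) : γ (s x) = s (α x) + f (α x) := by simp [f]
    refine ⟨f, hf, fun x y => ?_, (hpre f hf γ hγV hγf).1 hγpre⟩
    rw [CB.mul_comm' (s y)]
    exact (hmul f hf γ hγV hγf).1 hγmul x y
  · rintro ⟨f, hf, hfmul, hfpre⟩
    let γ : B →ₗ[k] B :=
      β ∘ₗ (LinearMap.id - s ∘ₗ j) + (s + f) ∘ₗ α.toLinearMap ∘ₗ j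
    have hγV (u : B) (hu : j u = 0) : γ u = β u := by simp [γ, hu]
    have hγf (x : A) : γ (s x) = s (α x) + f (α x) := by simp [γ, hs]
    have hjγ (b : B) : j (γ b) = α (j b) := by
      have h := hβV (b - s (j b)) (by simp [hs])
      rw [map_sub] at h
      simp [γ, hs, hf, h]
    refine ⟨γ, ⟨?_, fun c => ?_⟩, ⟨(hmul f hf γ hγV hγf).2 fun x y => ?_,
      (hpre f hf γ hγV hγf).2 hfpre⟩, fun u hu => by simp [hjγ, hu], hγV,
      fun x => by rw [hjγ, hs]⟩
    · refine (injective_iff_map_eq_zero γ).2 fun b hb => ?_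
      have hjb : j b = 0 := by simpa [hb] using (hjγ b).symm
      exact hβinj b hjb (by rw [← hγV b hjb, hb])
    · obtain ⟨v, hv, hβv⟩ := hβsurj (c - γ (s (α.symm (j c)))) (by simp [hjγ, hs])
      exact ⟨s (α.symm (j c)) + v, by rw [map_add, hγV v hv, hβv]; abel⟩
    · rw [CB.mul_comm' (f x)]
      exact hfmul x y
end
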